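/- For every γ > 0 there exist constants C₁(γ) > 0 and an absolute constant C₂ > 0 such that the following holds. For all positive integers t and d, every ε ∈ (0,1), every bounded interval I ⊆ ℝ, and every n ≥ C₁(γ) · t·(d+1)/ε², there exists a measurable estimator A : Iⁿ → {functions h : I → ℝ} whose output is always a piecewise polynomial function with at most C₂·t interval pieces each of degree at most d, such that for every probability density function f on I, with probability at least 9/10 over X_1, …, X_n drawn i.i.d. from the distribution with density f, the hypothesis h = A(X_1, …, X_n) satisfies ∫_I |f − h| ≤ (3+γ)·OPT_{t,d}(f) + ε. -/

import Mathlib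

open MeasureTheory Set

/-- `f` is a probability density function on `I`. -/
def IsPDFOn (f : ℝ → ℝ) (I : Set ℝ) : Prop :=
  (∀ x ∈ I, 0 ≤ f x) ∧ IntegrableOn f I ∧ (∫ x in I, f x) = 1

/-- The measure on `ℝ` with density `f` on `I`. -/
noncomputable def densityMeasure (I : Set ℝ) (f : ℝ → ℝ) : Measure ℝ :=
  (volume.restrict I).withDensity fun x => ENNReal.ofReal (f x)

/-- `h` is a `t`-piecewise degree-`d` polynomial on `I`: there is a partition of `I` into
at most `t` intervals on each of which `h` agrees with a real polynomial of degree at most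
`d`. -/
def PiecewisePoly (I : Set ℝ) (t d : ℕ) (h : ℝ → ℝ) : Prop :=
  ∃ P : Fin t → Set ℝ,
    (∀ i, (P i).OrdConnected) ∧
    (Pairwise fun i j => Disjoint (P i) (P j)) ∧
    (⋃ i, P i) = I ∧
    ∀ i, ∃ q : Polynomial ℝ, q.natDegree ≤ d ∧ ∀ x ∈ P i, h x = q.eval x

/-- `OPT_{t,d}(f)`: the infimum of `∫_I |f − r|` over all `t`-piecewise degree-`d`
polynomials `r` on `I`. -/
noncomputable def OPTpoly (I : Set ℝ) (t d : ℕ) (f : ℝ → ℝ) : ℝ :=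
  sInf { y : ℝ | ∃ r : ℝ → ℝ, PiecewisePoly I t d r ∧ y = ∫ x in I, |f x - r x| }

open Classical in
lemma card_crossing_le_two {ι : Type*} (s : Finset ι) (c : ι → Set ℝ)
    (hc : ∀ i, (c i).OrdConnected) (hd : Pairwise fun i j => Disjoint (c i) (c j))
    {S : Set ℝ} (hS : S.OrdConnected) :
    (s.filter fun i => (c i ∩ S).Nonempty ∧ ¬ c i ⊆ S).card ≤ 2 := by
  have hR : (s.filter fun i => ∃ x ∈ c i ∩ S, ∃ y ∈ c i \ S, x < y).card ≤ 1 := by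
    refine Finset.card_le_one.2 fun i hi j hj => ?_
    obtain ⟨-, x, hx, y, hy, hxy⟩ := Finset.mem_filter.1 hi
    obtain ⟨-, x', hx', y', hy', hxy'⟩ := Finset.mem_filter.1 hj
    by_contra hij
    rcases le_total x x' with h | h
    · have hlt : x' < y := by
        by_contra! hle
        exact hy.2 (hS.out hx.2 hx'.2 ⟨hxy.le, hle⟩)
      exact Set.disjoint_left.1 (hd hij) ((hc i).out hx.1 hy.1 ⟨h, hlt.le⟩) hx'.1
    · have hlt : x < y' := by
        by_contra! hle
        exact hy'.2 (hS.out hx'.2 hx.2 ⟨hxy'.le, hle⟩)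
      exact Set.disjoint_left.1 (hd hij) hx.1 ((hc j).out hx'.1 hy'.1 ⟨h, hlt.le⟩)
  have hL : (s.filter fun i => ∃ x ∈ c i ∩ S, ∃ y ∈ c i \ S, y < x).card ≤ 1 := by
    refine Finset.card_le_one.2 fun i hi j hj => ?_
    obtain ⟨-, x, hx, y, hy, hxy⟩ := Finset.mem_filter.1 hi
    obtain ⟨-, x', hx', y', hy', hxy'⟩ := Finset.mem_filter.1 hj
    by_contra hij
    rcases le_total x x' with h | h
    · have hlt : y' < x := by
        by_contra! hle
        exact hy'.2 (hS.out hx.2 hx'.2 ⟨hle, hxy'.le⟩)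
      exact Set.disjoint_left.1 (hd hij) hx.1 ((hc j).out hy'.1 hx'.1 ⟨hlt.le, h⟩)
    · have hlt : y < x' := by
        by_contra! hle
        exact hy.2 (hS.out hx'.2 hx.2 ⟨hle, hxy.le⟩)
      exact Set.disjoint_left.1 (hd hij) ((hc i).out hy.1 hx.1 ⟨hlt.le, h⟩) hx'.1
  have hsub : (s.filter fun i => (c i ∩ S).Nonempty ∧ ¬ c i ⊆ S) ⊆
      (s.filter fun i => ∃ x ∈ c i ∩ S, ∃ y ∈ c i \ S, x < y) ∪
      (s.filter fun i => ∃ x ∈ c i ∩ S, ∃ y ∈ c i \ S, y < x) := by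
    intro i hi
    obtain ⟨his, ⟨x, hx⟩, hn⟩ := Finset.mem_filter.1 hi
    obtain ⟨y, hyc, hyS⟩ := Set.not_subset.1 hn
    rw [Finset.mem_union, Finset.mem_filter, Finset.mem_filter]
    rcases lt_trichotomy x y with h | h | h
    · exact .inl ⟨his, x, hx, y, ⟨hyc, hyS⟩, h⟩
    · exact absurd (h ▸ hx.2) hyS
    · exact .inr ⟨his, x, hx, y, ⟨hyc, hyS⟩, h⟩
  calc _ ≤ _ := Finset.card_le_card hsub
    _ ≤ _ := Finset.card_union_le _ _
    _ ≤ 2 := by omega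

/-- The sign of `h - g` on `I`, extended by zero. -/
noncomputable def signDiff (I : Set ℝ) (h g : ℝ → ℝ) : ℝ → ℝ :=
  I.indicator fun x => Real.sign (h x - g x)

open Classical in
lemma card_meeting_pairs_le {t : ℕ} {P Q : Fin t → Set ℝ}
    (hP : ∀ i, (P i).OrdConnected) (hPd : Pairwise fun i j => Disjoint (P i) (P j))
    (hQ : ∀ i, (Q i).OrdConnected) (hQd : Pairwise fun i j => Disjoint (Q i) (Q j)) :
    (Finset.univ.filter fun p : Fin t × Fin t => (Q p.2 ∩ P p.1).Nonempty).card ≤ 3 * t := by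
  set U := Finset.univ.filter fun p : Fin t × Fin t => (Q p.2 ∩ P p.1).Nonempty
  have h1 : (U.filter fun p => Q p.2 ⊆ P p.1).card ≤ t := by
    have := Finset.card_le_card_of_injOn (s := U.filter fun p => Q p.2 ⊆ P p.1)
      (t := (Finset.univ : Finset (Fin t))) Prod.snd (by simp) (by
        rintro ⟨i, j⟩ hi ⟨i', j'⟩ hi' (rfl : j = j')
        simp only [U, Finset.coe_filter, Finset.mem_filter, Finset.mem_univ, true_and,
          Set.mem_ofPred_eq] at hi hi'
        by_contra hne
        have hii : i ≠ i' := fun h => hne (by rw [h])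
        obtain ⟨x, hx⟩ := hi.1
        exact Set.disjoint_left.1 (hPd hii) (hi.2 hx.1) (hi'.2 hx.1))
    simpa using this
  have h2 : (U.filter fun p => ¬ Q p.2 ⊆ P p.1).card ≤ 2 * t := by
    have hsub : (U.filter fun p => ¬ Q p.2 ⊆ P p.1) ⊆
        Finset.univ.biUnion fun i : Fin t =>
          (Finset.univ.filter fun j => (Q j ∩ P i).Nonempty ∧ ¬ Q j ⊆ P i).image
            (Prod.mk i) := by
      rintro ⟨i, j⟩ hij
      simpa [U] using hij
    refine (Finset.card_le_card hsub).trans ?_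
    refine (Finset.card_biUnion_le_card_mul _ _ 2 fun i _ => ?_).trans (by simp [mul_comm])
    exact Finset.card_image_le.trans (card_crossing_le_two _ Q hQ hQd (hP i))
  have := Finset.card_filter_add_card_filter_not (s := U) (fun p => Q p.2 ⊆ P p.1)
  omega

lemma exists_root_of_sign_ne {D : Polynomial ℝ} {c : Set ℝ} (hc : c.OrdConnected) {x y : ℝ}
    (hx : x ∈ c) (hy : y ∈ c) (hs : Real.sign (D.eval x) ≠ Real.sign (D.eval y)) :
    D ≠ 0 ∧ ∃ z ∈ c, D.IsRoot z := by
  refine ⟨fun h => hs (by simp [h]), ?_⟩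
  have hcont : ContinuousOn (fun z => D.eval z) c := D.continuous.continuousOn
  rcases lt_trichotomy (D.eval x) 0 with h | h | h
  · rcases lt_or_ge (D.eval y) 0 with h' | h'
    · exact absurd (by rw [Real.sign_of_neg h, Real.sign_of_neg h']) hs
    · obtain ⟨z, hz, hz'⟩ := hc.isPreconnected.intermediate_value hx hy hcont ⟨h.le, h'⟩
      exact ⟨z, hz, hz'⟩
  · exact ⟨x, hx, h⟩
  · rcases lt_or_ge 0 (D.eval y) with h' | h'
    · exact absurd (by rw [Real.sign_of_pos h, Real.sign_of_pos h']) hs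
    · obtain ⟨z, hz, hz'⟩ := hc.isPreconnected.intermediate_value hy hx hcont ⟨h', h.le⟩
      exact ⟨z, hz, hz'⟩

open Classical in
lemma card_signDiff_nonconst_le {I : Set ℝ} {t d : ℕ} {h g : ℝ → ℝ}
    (hh : PiecewisePoly I t d h) (hg : PiecewisePoly I t d g)
    {ι : Type*} (s : Finset ι) (c : ι → Set ℝ)
    (hc : ∀ i, (c i).OrdConnected) (hd : Pairwise fun i j => Disjoint (c i) (c j)) :
    (s.filter fun k => ∃ x ∈ c k, ∃ y ∈ c k, signDiff I h g x ≠ signDiff I h g y).card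
      ≤ 4 * (t * (d + 1)) := by
  obtain ⟨P, hP, hPd, hPI, hp⟩ := hh
  obtain ⟨Q, hQ, hQd, hQI, hq⟩ := hg
  choose p hpd hpe using hp
  choose q hqd hqe using hq
  set U := Finset.univ.filter fun p : Fin t × Fin t => (Q p.2 ∩ P p.1).Nonempty
  have hsub : (s.filter fun k => ∃ x ∈ c k, ∃ y ∈ c k, signDiff I h g x ≠ signDiff I h g y) ⊆
      (Finset.univ.biUnion fun i => s.filter fun k => (c k ∩ P i).Nonempty ∧ ¬ c k ⊆ P i) ∪
      (Finset.univ.biUnion fun i => s.filter fun k => (c k ∩ Q i).Nonempty ∧ ¬ c k ⊆ Q i) ∪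
      (U.biUnion fun e => s.filter fun k =>
        p e.1 - q e.2 ≠ 0 ∧ ∃ z ∈ c k, (p e.1 - q e.2).IsRoot z) := by
    intro k hk
    obtain ⟨hks, x, hx, y, hy, hxy⟩ := Finset.mem_filter.1 hk
    have hmeet : ∃ x ∈ c k, x ∈ I := by
      by_contra! hno
      simp [signDiff, hno x hx, hno y hy] at hxy
    obtain ⟨w, hw, hwI⟩ := hmeet
    obtain ⟨i, hi⟩ := Set.mem_iUnion.1 (hPI.symm ▸ hwI)
    obtain ⟨j, hj⟩ := Set.mem_iUnion.1 (hQI.symm ▸ hwI)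
    simp only [Finset.mem_union, Finset.mem_biUnion, Finset.mem_filter, Finset.mem_univ,
      true_and]
    by_cases hci : c k ⊆ P i
    · by_cases hcj : c k ⊆ Q j
      · right
        have hev : ∀ z ∈ c k, signDiff I h g z = Real.sign ((p i - q j).eval z) := by
          intro z hz
          have hzI : z ∈ I := hPI ▸ Set.mem_iUnion.2 ⟨i, hci hz⟩
          simp [signDiff, hzI, hpe i z (hci hz), hqe j z (hcj hz)]
        rw [hev x hx, hev y hy] at hxy
        exact ⟨(i, j), by simpa [U] using ⟨w, hj, hi⟩, hks,
          exists_root_of_sign_ne (hc k) hx hy hxy⟩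
      · exact .inl (.inr ⟨j, hks, ⟨w, hw, hj⟩, hcj⟩)
    · exact .inl (.inl ⟨i, hks, ⟨w, hw, hi⟩, hci⟩)
  have hroots : ∀ e ∈ U, (s.filter fun k =>
      p e.1 - q e.2 ≠ 0 ∧ ∃ z ∈ c k, (p e.1 - q e.2).IsRoot z).card ≤ d := by
    intro e _
    by_cases h0 : p e.1 - q e.2 = 0
    · simp [h0]
    have hz : ∀ k ∈ s.filter fun k => p e.1 - q e.2 ≠ 0 ∧ ∃ z ∈ c k, (p e.1 - q e.2).IsRoot z,
        ∃ z ∈ c k, (p e.1 - q e.2).IsRoot z := fun k hk => (Finset.mem_filter.1 hk).2.2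
    choose! z hzc hzr using hz
    calc _ ≤ (p e.1 - q e.2).roots.toFinset.card := by
          refine Finset.card_le_card_of_injOn z (fun k hk => ?_) fun k hk k' hk' hkk => ?_
          · simp only [Finset.mem_coe, Multiset.mem_toFinset]
            exact (Polynomial.mem_roots h0).2 (hzr k hk)
          · by_contra hne
            exact Set.disjoint_left.1 (hd hne) (hzc k hk) (hkk ▸ hzc k' hk')
      _ ≤ Multiset.card (p e.1 - q e.2).roots := Multiset.toFinset_card_le _
      _ ≤ (p e.1 - q e.2).natDegree := Polynomial.card_roots' _
      _ ≤ d := (Polynomial.natDegree_sub_le _ _).trans (max_le (hpd _) (hqd _))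
  have hU : U.card ≤ 3 * t := card_meeting_pairs_le hP hPd hQ hQd
  have h1 := Finset.card_biUnion_le_card_mul Finset.univ
    (fun i => s.filter fun k => (c k ∩ P i).Nonempty ∧ ¬ c k ⊆ P i) 2
    fun i _ => card_crossing_le_two s c hc hd (hP i)
  have h2 := Finset.card_biUnion_le_card_mul Finset.univ
    (fun i => s.filter fun k => (c k ∩ Q i).Nonempty ∧ ¬ c k ⊆ Q i) 2
    fun i _ => card_crossing_le_two s c hc hd (hQ i)
  have h3 := Finset.card_biUnion_le_card_mul U _ d hroots
  have h4 : U.card * d ≤ 3 * t * d := Nat.mul_le_mul_right _ hU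
  rw [Finset.card_univ, Fintype.card_fin] at h1 h2
  refine (Finset.card_le_card hsub).trans <| (Finset.card_union_le _ _).trans <|
    (Nat.add_le_add_right (Finset.card_union_le _ _) _).trans ?_
  nlinarith [Nat.zero_le (t * d)]

lemma le_add_pow_four_div {lam b : ℝ} (hlam : 0 < lam) (hb : 0 ≤ b) :
    b ≤ lam + b ^ 4 / lam ^ 3 := by
  rcases le_total b lam with h | h
  · have : 0 ≤ b ^ 4 / lam ^ 3 := by positivity
    linarith
  · have : b ≤ b ^ 4 / lam ^ 3 := by
      rw [le_div_iff₀ (by positivity)]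
      have := mul_le_mul_of_nonneg_left (pow_le_pow_left₀ hlam.le h 3) hb
      nlinarith
    linarith

lemma sum_range_two_mul (N : ℕ) (u : ℕ → ℝ) :
    ∑ k ∈ Finset.range (2 * N), u k =
      ∑ k ∈ Finset.range N, (u (2 * k) + u (2 * k + 1)) := by
  induction N with
  | zero => simp
  | succ N ih =>
    rw [Finset.sum_range_succ, ← ih, show 2 * (N + 1) = 2 * N + 1 + 1 by ring,
      Finset.sum_range_succ, Finset.sum_range_succ, add_assoc]

open Classical in
lemma chaining_bound {a b : ℕ → ℕ → ℝ} {N K J : ℕ} {C : ℕ → ℕ → Prop} {lam : ℕ → ℝ} {δ : ℝ}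
    (ha : ∀ j k, 0 ≤ a j k) (hb : ∀ j k, 0 ≤ b j k) (hlam : ∀ j, 0 < lam j)
    (hδ : 0 ≤ δ) (hN : N ≤ 2 * K)
    (hsplit : ∀ j k, a j k ≤ a (j + 1) (2 * k) + a (j + 1) (2 * k + 1))
    (hnon : ∀ j k, ¬ C j k → a j k ≤ b j k)
    (hcard : ∀ j, ((Finset.range (N * 2 ^ j)).filter (C j)).card ≤ K)
    (hlast : ∀ k, a J k ≤ b J k + δ) :
    ∑ k ∈ Finset.range N, a 0 k ≤
      2 * ∑ j ∈ Finset.range (J + 1), (2 * K * lam j +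
        (∑ k ∈ Finset.range (N * 2 ^ j), b j k ^ 4) / lam j ^ 3) + K * δ := by
  set Q : ℕ → ℝ := fun j => (∑ k ∈ Finset.range (N * 2 ^ j), b j k ^ 4) / lam j ^ 3
  have hQ : ∀ j, 0 ≤ Q j := fun j =>
    div_nonneg (Finset.sum_nonneg fun k _ => pow_nonneg (hb j k) 4) (pow_nonneg (hlam j).le 3)
  set T : ℕ → ℝ := fun j => ∑ k ∈ (Finset.range (N * 2 ^ j)).filter (C j), a j k with hT
  have hcell : ∀ j k, a j k ≤ (if C j k then a j k else 0) + lam j + b j k ^ 4 / lam j ^ 3 := by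
    intro j k
    have h1 := le_add_pow_four_div (hlam j) (hb j k)
    split_ifs with h
    · have : 0 ≤ b j k ^ 4 / lam j ^ 3 :=
        div_nonneg (pow_nonneg (hb j k) 4) (pow_nonneg (hlam j).le 3)
      linarith [hlam j]
    · linarith [hnon j k h]
  have hstep : ∀ j, T j ≤ T (j + 1) + (2 * K * lam (j + 1) + Q (j + 1)) := by
    intro j
    set u : ℕ → ℝ := fun k => (if C (j + 1) k then a (j + 1) k else 0) +
      b (j + 1) k ^ 4 / lam (j + 1) ^ 3 with hu
    have hu0 : ∀ k, 0 ≤ u k := fun k => add_nonneg (by split_ifs <;> simp [ha])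
      (div_nonneg (pow_nonneg (hb _ k) 4) (pow_nonneg (hlam _).le 3))
    calc T j ≤ ∑ k ∈ (Finset.range (N * 2 ^ j)).filter (C j),
          ((u (2 * k) + u (2 * k + 1)) + 2 * lam (j + 1)) := by
          refine Finset.sum_le_sum fun k _ => (hsplit j k).trans ?_
          have h1 := hcell (j + 1) (2 * k)
          have h2 := hcell (j + 1) (2 * k + 1)
          simp only [hu]
          linarith
      _ = ∑ k ∈ (Finset.range (N * 2 ^ j)).filter (C j), (u (2 * k) + u (2 * k + 1)) +
          ((Finset.range (N * 2 ^ j)).filter (C j)).card * (2 * lam (j + 1)) := by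
          rw [Finset.sum_add_distrib, Finset.sum_const, nsmul_eq_mul]
      _ ≤ ∑ k ∈ Finset.range (N * 2 ^ j), (u (2 * k) + u (2 * k + 1)) +
          K * (2 * lam (j + 1)) := by
          refine add_le_add (Finset.sum_le_sum_of_subset_of_nonneg (Finset.filter_subset _ _)
            fun k _ _ => add_nonneg (hu0 _) (hu0 _))
            (mul_le_mul_of_nonneg_right (by exact_mod_cast hcard j) (by linarith [hlam (j + 1)]))
      _ = T (j + 1) + (2 * K * lam (j + 1) + Q (j + 1)) := by
          rw [← sum_range_two_mul, show 2 * (N * 2 ^ j) = N * 2 ^ (j + 1) by ring]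
          simp only [hu, hT, Q, Finset.sum_add_distrib, Finset.sum_filter, Finset.sum_div]
          ring
  have hT0 : T 0 ≤ T J + ∑ j ∈ Finset.range J, (2 * K * lam (j + 1) + Q (j + 1)) := by
    clear hlast
    induction J with
    | zero => simp
    | succ J ih => rw [Finset.sum_range_succ]; linarith [hstep J]
  have hTJ : T J ≤ 2 * K * lam J + Q J + K * δ := by
    calc T J ≤ ∑ k ∈ (Finset.range (N * 2 ^ J)).filter (C J),
          (b J k ^ 4 / lam J ^ 3 + (lam J + δ)) := by
          refine Finset.sum_le_sum fun k _ => (hlast k).trans ?_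
          linarith [le_add_pow_four_div (hlam J) (hb J k)]
      _ = ∑ k ∈ (Finset.range (N * 2 ^ J)).filter (C J), b J k ^ 4 / lam J ^ 3 +
          ((Finset.range (N * 2 ^ J)).filter (C J)).card * (lam J + δ) := by
          rw [Finset.sum_add_distrib, Finset.sum_const, nsmul_eq_mul]
      _ ≤ Q J + K * (lam J + δ) := by
          refine add_le_add ?_
            (mul_le_mul_of_nonneg_right (by exact_mod_cast hcard J) (by linarith [hlam J]))
          simp only [Q, Finset.sum_div]
          exact Finset.sum_le_sum_of_subset_of_nonneg (Finset.filter_subset _ _)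
            fun k _ _ => div_nonneg (pow_nonneg (hb _ k) 4) (pow_nonneg (hlam _).le 3)
      _ ≤ _ := by nlinarith [mul_nonneg (Nat.cast_nonneg (α := ℝ) K) (hlam J).le]
  have h0 : ∑ k ∈ Finset.range N, a 0 k ≤ T 0 + (2 * K * lam 0 + Q 0) := by
    calc ∑ k ∈ Finset.range N, a 0 k
        ≤ ∑ k ∈ Finset.range N,
          ((if C 0 k then a 0 k else 0) + lam 0 + b 0 k ^ 4 / lam 0 ^ 3) :=
          Finset.sum_le_sum fun k _ => hcell 0 k
      _ = T 0 + (N * lam 0 + Q 0) := by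
          simp only [hT, Q, Finset.sum_add_distrib, Finset.sum_filter, Finset.sum_div,
            Finset.sum_const, nsmul_eq_mul, Finset.card_range, pow_zero, mul_one]
          ring
      _ ≤ _ := by
          have : (N : ℝ) ≤ 2 * K := by exact_mod_cast hN
          nlinarith [hlam 0]
  have hpos : ∀ j, 0 ≤ 2 * K * lam j + Q j := fun j =>
    add_nonneg (mul_nonneg (by positivity) (hlam j).le) (hQ j)
  have hs1 : ∑ j ∈ Finset.range (J + 1), (2 * K * lam j + Q j) =
      ∑ j ∈ Finset.range J, (2 * K * lam (j + 1) + Q (j + 1)) + (2 * K * lam 0 + Q 0) :=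
    Finset.sum_range_succ' _ _
  have hs2 : 2 * K * lam J + Q J ≤ ∑ j ∈ Finset.range (J + 1), (2 * K * lam j + Q j) :=
    Finset.single_le_sum (f := fun j => 2 * K * lam j + Q j) (fun j _ => hpos j) (by simp)
  linarith

lemma integrable_of_abs_le {Ω : Type*} [MeasurableSpace Ω] {P : Measure Ω} [IsFiniteMeasure P]
    {g : Ω → ℝ} (hg : Measurable g) {B : ℝ} (hB : ∀ ω, |g ω| ≤ B) : Integrable g P :=
  Integrable.of_bound hg.aestronglyMeasurable B (.of_forall hB)

lemma integral_add_pow_of_indep {Ω : Type*} [MeasurableSpace Ω] {P : Measure Ω}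
    [IsProbabilityMeasure P] {Y Z : Ω → ℝ} (hY : Measurable Y) (hZ : Measurable Z) {B : ℝ}
    (hYB : ∀ ω, |Y ω| ≤ B) (hZB : ∀ ω, |Z ω| ≤ 1) (hYZ : ProbabilityTheory.IndepFun Y Z P)
    (hY0 : ∫ ω, Y ω ∂P = 0) (hZ0 : ∫ ω, Z ω ∂P = 0) :
    (∫ ω, (Y ω + Z ω) ^ 2 ∂P = ∫ ω, Y ω ^ 2 ∂P + ∫ ω, Z ω ^ 2 ∂P) ∧
    (∫ ω, (Y ω + Z ω) ^ 4 ∂P = ∫ ω, Y ω ^ 4 ∂P +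
      6 * ((∫ ω, Y ω ^ 2 ∂P) * ∫ ω, Z ω ^ 2 ∂P) + ∫ ω, Z ω ^ 4 ∂P) := by
  have hint : ∀ a b : ℕ, Integrable (fun ω => Y ω ^ a * Z ω ^ b) P := fun a b => by
    refine integrable_of_abs_le (by fun_prop) (B := B ^ a * 1 ^ b) fun ω => ?_
    rw [abs_mul, abs_pow, abs_pow]
    exact mul_le_mul (pow_le_pow_left₀ (abs_nonneg _) (hYB ω) _)
      (pow_le_pow_left₀ (abs_nonneg _) (hZB ω) _) (by positivity)
      (pow_nonneg ((abs_nonneg _).trans (hYB ω)) _)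
  have hmul : ∀ a b : ℕ, ∫ ω, Y ω ^ a * Z ω ^ b ∂P = (∫ ω, Y ω ^ a ∂P) * ∫ ω, Z ω ^ b ∂P :=
    fun a b => (hYZ.comp (φ := fun y => y ^ a) (ψ := fun z => z ^ b) (by fun_prop)
      (by fun_prop)).integral_fun_mul_eq_mul_integral (by fun_prop) (by fun_prop)
  have i20 := hint 2 0
  have i11 := hint 1 1
  have i02 := hint 0 2
  have i40 := hint 4 0
  have i31 := hint 3 1
  have i22 := hint 2 2
  have i13 := hint 1 3
  have i04 := hint 0 4
  constructor
  · rw [show (fun ω => (Y ω + Z ω) ^ 2) = fun ω => Y ω ^ 2 * Z ω ^ 0 +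
      2 * (Y ω ^ 1 * Z ω ^ 1) + Y ω ^ 0 * Z ω ^ 2 by ext; ring]
    rw [integral_add (by fun_prop) (by fun_prop), integral_add (by fun_prop) (by fun_prop),
      integral_const_mul, hmul, hmul, hmul]
    simp [hY0]
  · rw [show (fun ω => (Y ω + Z ω) ^ 4) = fun ω => Y ω ^ 4 * Z ω ^ 0 +
      4 * (Y ω ^ 3 * Z ω ^ 1) + 6 * (Y ω ^ 2 * Z ω ^ 2) + 4 * (Y ω ^ 1 * Z ω ^ 3) +
      Y ω ^ 0 * Z ω ^ 4 by ext; ring]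
    rw [integral_add (by fun_prop) (by fun_prop), integral_add (by fun_prop) (by fun_prop),
      integral_add (by fun_prop) (by fun_prop), integral_add (by fun_prop) (by fun_prop),
      integral_const_mul, integral_const_mul, integral_const_mul, hmul, hmul, hmul, hmul, hmul]
    simp [hY0, hZ0]

lemma moments_sum_le {Ω ι : Type*} [MeasurableSpace Ω] {P : Measure Ω}
    [IsProbabilityMeasure P] {ξ : ι → Ω → ℝ} (hm : ∀ i, Measurable (ξ i))
    (hb : ∀ i ω, |ξ i ω| ≤ 1) (hind : ProbabilityTheory.iIndepFun ξ P)
    (h0 : ∀ i, ∫ ω, ξ i ω ∂P = 0) {v : ℝ} (hv : ∀ i, ∫ ω, ξ i ω ^ 2 ∂P ≤ v) (hv0 : 0 ≤ v)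
    (s : Finset ι) :
    (∫ ω, (∑ i ∈ s, ξ i ω) ^ 2 ∂P ≤ s.card * v) ∧
    (∫ ω, (∑ i ∈ s, ξ i ω) ^ 4 ∂P ≤ 3 * s.card ^ 2 * v ^ 2 + s.card * v) := by
  classical
  induction s using Finset.induction_on with
  | empty => simp
  | insert j s hj ih =>
    have hbs : ∀ ω, |∑ i ∈ s, ξ i ω| ≤ s.card := fun ω =>
      (Finset.abs_sum_le_sum_abs _ _).trans
        ((Finset.sum_le_sum fun i _ => hb i ω).trans (by simp))
    have hms : Measurable fun ω => ∑ i ∈ s, ξ i ω := by fun_prop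
    have hi : ProbabilityTheory.IndepFun (fun ω => ∑ i ∈ s, ξ i ω) (ξ j) P := by
      have := hind.indepFun_finsetSum_of_notMem hm hj
      rwa [show (fun ω => ∑ i ∈ s, ξ i ω) = ∑ i ∈ s, ξ i by ext; simp]
    have hs0 : ∫ ω, ∑ i ∈ s, ξ i ω ∂P = 0 := by
      rw [integral_finsetSum _ fun i _ => integrable_of_abs_le (hm i) (hb i)]
      simp [h0]
    obtain ⟨e2, e4⟩ := integral_add_pow_of_indep hms (hm j) hbs (hb j) hi hs0 (h0 j)
    have hj4 : ∫ ω, ξ j ω ^ 4 ∂P ≤ v := by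
      refine (integral_mono ?_ ?_ fun ω => ?_).trans (hv j)
      · exact integrable_of_abs_le (by fun_prop) (B := 1)
          fun ω => by rw [abs_pow]; exact pow_le_one₀ (abs_nonneg _) (hb j ω)
      · exact integrable_of_abs_le (by fun_prop) (B := 1)
          fun ω => by rw [abs_pow]; exact pow_le_one₀ (abs_nonneg _) (hb j ω)
      · have : ξ j ω ^ 2 ≤ 1 := (sq_le_one_iff_abs_le_one _).2 (hb j ω)
        show ξ j ω ^ 4 ≤ ξ j ω ^ 2
        nlinarith [sq_nonneg (ξ j ω)]
    have hY2 : 0 ≤ ∫ ω, (∑ i ∈ s, ξ i ω) ^ 2 ∂P := integral_nonneg fun ω => by positivity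
    have hprod : (∫ ω, (∑ i ∈ s, ξ i ω) ^ 2 ∂P) * ∫ ω, ξ j ω ^ 2 ∂P ≤ (s.card * v) * v :=
      mul_le_mul ih.1 (hv j) (integral_nonneg fun ω => by positivity) (by positivity)
    have hcomm : ∀ ω, ∑ i ∈ insert j s, ξ i ω = ∑ i ∈ s, ξ i ω + ξ j ω := fun ω => by
      rw [Finset.sum_insert hj, add_comm]
    simp only [hcomm, e2, e4, Finset.card_insert_of_notMem hj]
    push_cast
    constructor
    · nlinarith [hv j, ih.1]
    · nlinarith [ih.2, sq_nonneg v]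

/-- The deviation of the empirical mean of `g` from its expectation. -/
noncomputable def empDev (μ : Measure ℝ) {n : ℕ} (X : Fin n → ℝ) (g : ℝ → ℝ) : ℝ :=
  (∑ i, g (X i)) / n - ∫ x, g x ∂μ

lemma measurable_empDev (μ : Measure ℝ) {n : ℕ} {g : ℝ → ℝ} (hg : Measurable g) :
    Measurable fun X : Fin n → ℝ => empDev μ X g := by
  unfold empDev
  fun_prop

lemma abs_empDev_le {μ : Measure ℝ} [IsProbabilityMeasure μ] {n : ℕ}
    (X : Fin n → ℝ) {g : ℝ → ℝ} (hb : ∀ x, |g x| ≤ 1) :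
    |empDev μ X g| ≤ 2 := by
  have h1 : |(∑ i, g (X i)) / (n : ℝ)| ≤ 1 := by
    rw [abs_div, Nat.abs_cast]
    refine div_le_one_of_le₀ ((Finset.abs_sum_le_sum_abs _ _).trans
        ((Finset.sum_le_sum fun i _ => hb (X i)).trans (by simp))) (by positivity)
  have h2 : |∫ x, g x ∂μ| ≤ 1 := by
    simpa using norm_integral_le_of_norm_le_const (μ := μ) (f := g) (.of_forall hb)
  exact (abs_sub _ _).trans (by linarith)

lemma integral_empDev_indicator_pow_four_le {μ : Measure ℝ} [IsProbabilityMeasure μ] {n : ℕ}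
    {c : Set ℝ} (hc : MeasurableSet c) {p : ℝ} (hp : μ.real c ≤ p) (hnp : 1 ≤ n * p) :
    ∫ X, empDev μ X (c.indicator 1) ^ 4 ∂(Measure.pi fun _ : Fin n => μ) ≤
      4 * p ^ 2 / n ^ 2 := by
  have hn : 0 < (n : ℝ) := by
    rcases Nat.eq_zero_or_pos n with h | h
    · subst h; norm_num at hnp
    · exact_mod_cast h
  have hp0 : 0 ≤ p := measureReal_nonneg.trans hp
  set g : ℝ → ℝ := fun x => c.indicator 1 x - μ.real c with hg
  have hgm : Measurable g := (measurable_one.indicator hc).sub_const _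
  have hgi : ∫ x, c.indicator (1 : ℝ → ℝ) x ∂μ = μ.real c := integral_indicator_one hc
  have hgint : Integrable (c.indicator (1 : ℝ → ℝ)) μ :=
    integrable_of_abs_le (measurable_one.indicator hc) (B := 1) fun x => by
      by_cases h : x ∈ c <;> simp [h]
  have hg0 : ∫ x, g x ∂μ = 0 := by
    simp only [hg]
    rw [integral_sub hgint (integrable_const _), hgi]
    simp
  have hgb : ∀ x, |g x| ≤ 1 := fun x => by
    have h0 : 0 ≤ μ.real c := measureReal_nonneg
    have h1 : μ.real c ≤ 1 := measureReal_le_one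
    simp only [hg]
    by_cases h : x ∈ c
    · simp only [h, indicator_of_mem, Pi.one_apply]; rw [abs_le]; constructor <;> linarith
    · simp only [h, not_false_eq_true, indicator_of_notMem]; rw [abs_le]; constructor <;> linarith
  have hg2 : ∫ x, g x ^ 2 ∂μ ≤ p := by
    have : ∀ x, g x ^ 2 = (1 - 2 * μ.real c) * c.indicator (1 : ℝ → ℝ) x + μ.real c ^ 2 := by
      intro x
      simp only [hg]
      by_cases h : x ∈ c
      · simp [h]; ring
      · simp [h]
    simp only [this]
    rw [integral_add (hgint.const_mul _) (integrable_const _), integral_const_mul, hgi]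
    simp
    nlinarith [sq_nonneg (μ.real c)]
  have hind : ProbabilityTheory.iIndepFun (fun (i : Fin n) (X : Fin n → ℝ) => g (X i))
      (Measure.pi fun _ : Fin n => μ) :=
    ProbabilityTheory.iIndepFun_pi (X := fun _ => g) fun _ => hgm.aemeasurable
  have hmom := (moments_sum_le (ξ := fun (i : Fin n) (X : Fin n → ℝ) => g (X i))
    (fun i => hgm.comp (measurable_pi_apply i))
    (fun i X => hgb (X i)) hind
    (fun i => by
      rw [integral_comp_eval (μ := fun _ : Fin n => μ) (i := i) hgm.aestronglyMeasurable, hg0])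
    (fun i => by
      rw [integral_comp_eval (μ := fun _ : Fin n => μ) (i := i) (f := fun x => g x ^ 2)
        (hgm.pow_const 2).aestronglyMeasurable]
      exact hg2) hp0 Finset.univ).2
  have hdev : ∀ X : Fin n → ℝ, empDev μ X (c.indicator 1) = (∑ i, g (X i)) / n := by
    intro X
    simp only [empDev, hgi, hg, Finset.sum_sub_distrib]
    simp
    field_simp
  simp only [hdev, div_pow]
  rw [integral_div, div_le_div_iff₀ (by positivity) (by positivity)]
  simp only [Finset.card_univ, Fintype.card_fin] at hmom
  have h3 : 3 * (n : ℝ) ^ 2 * p ^ 2 + n * p ≤ 4 * (n : ℝ) ^ 2 * p ^ 2 := by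
    have : 0 ≤ n * p := by positivity
    nlinarith
  have := mul_le_mul_of_nonneg_right (hmom.trans h3) (sq_nonneg (n : ℝ))
  nlinarith

/-- The `k`-th cell, at scale `j`, of the partition of the line into level sets of
`⌊K * 2 ^ j * U⌋₊`. -/
def dyadicCell (U : ℝ → ℝ) (K j k : ℕ) : Set ℝ :=
  {x | ⌊(K * 2 ^ j : ℝ) * U x⌋₊ = k}

lemma ordConnected_dyadicCell {U : ℝ → ℝ} (hU : Monotone U) (K j k : ℕ) :
    (dyadicCell U K j k).OrdConnected := by
  have hmono : Monotone fun x => ⌊(K * 2 ^ j : ℝ) * U x⌋₊ :=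
    fun x y hxy => Nat.floor_mono (mul_le_mul_of_nonneg_left (hU hxy) (by positivity))
  exact (ordConnected_singleton (a := k)).preimage_mono hmono

lemma disjoint_dyadicCell (U : ℝ → ℝ) (K j : ℕ) :
    Pairwise fun k l => Disjoint (dyadicCell U K j k) (dyadicCell U K j l) := by
  intro k l hkl
  rw [Set.disjoint_left]
  rintro x (hx : _ = k) (hy : _ = l)
  exact hkl (hx.symm.trans hy)

lemma indicator_dyadicCell_eq_add (U : ℝ → ℝ) (K j k : ℕ) (s : ℝ → ℝ) (x : ℝ) :
    (dyadicCell U K j k).indicator s x = (dyadicCell U K (j + 1) (2 * k)).indicator s x +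
      (dyadicCell U K (j + 1) (2 * k + 1)).indicator s x := by
  classical
  have h : ⌊(K * 2 ^ j : ℝ) * U x⌋₊ = ⌊(K * 2 ^ (j + 1) : ℝ) * U x⌋₊ / 2 := by
    rw [← Nat.floor_div_ofNat]
    congr 1
    rw [pow_succ]
    ring
  simp only [dyadicCell, Set.indicator_apply, Set.mem_ofPred_eq, h]
  split_ifs <;> first | omega | simp

lemma sum_indicator_dyadicCell {U : ℝ → ℝ} (hU1 : ∀ x, U x ≤ 1) (K : ℕ) (s : ℝ → ℝ) (x : ℝ) :
    ∑ k ∈ Finset.range (K + 1), (dyadicCell U K 0 k).indicator s x = s x := by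
  classical
  have h : ⌊(K * 2 ^ 0 : ℝ) * U x⌋₊ < K + 1 := by
    refine Nat.lt_succ_of_le (Nat.floor_le_of_le ?_)
    have := mul_le_mul_of_nonneg_left (hU1 x) (Nat.cast_nonneg (α := ℝ) K)
    simpa using this
  simp only [dyadicCell, Set.indicator_apply, Set.mem_ofPred_eq]
  rw [Finset.sum_ite_eq, if_pos (Finset.mem_range.2 h)]

lemma empDev_add (μ : Measure ℝ) {n : ℕ} (X : Fin n → ℝ) {g h : ℝ → ℝ} (hg : Integrable g μ)
    (hh : Integrable h μ) :
    empDev μ X (fun x => g x + h x) = empDev μ X g + empDev μ X h := by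
  simp only [empDev, Finset.sum_add_distrib, integral_add hg hh]
  ring

lemma empDev_sum (μ : Measure ℝ) {n : ℕ} (X : Fin n → ℝ) {ι : Type*} (T : Finset ι)
    {g : ι → ℝ → ℝ} (hg : ∀ i, Integrable (g i) μ) :
    empDev μ X (fun x => ∑ i ∈ T, g i x) = ∑ i ∈ T, empDev μ X (g i) := by
  simp only [empDev, Finset.sum_sub_distrib]
  rw [integral_finsetSum _ fun i _ => hg i, Finset.sum_comm, Finset.sum_div]

lemma empDev_const_mul (μ : Measure ℝ) {n : ℕ} (X : Fin n → ℝ) (v : ℝ) (g : ℝ → ℝ) :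
    empDev μ X (fun x => v * g x) = v * empDev μ X g := by
  simp only [empDev, integral_const_mul, ← Finset.mul_sum]
  ring

lemma abs_indicator_le_one {s : ℝ → ℝ} (hs : ∀ x, |s x| ≤ 1) (c : Set ℝ) (x : ℝ) :
    |c.indicator s x| ≤ 1 := by
  by_cases h : x ∈ c <;> simp [h, hs]

lemma abs_empDev_indicator_le {μ : Measure ℝ} [IsProbabilityMeasure μ] {n : ℕ} (X : Fin n → ℝ)
    {s : ℝ → ℝ} (hs : ∀ x, |s x| ≤ 1) {c : Set ℝ} (hc : MeasurableSet c) :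
    |empDev μ X (c.indicator s)| ≤ |empDev μ X (c.indicator 1)| + 2 * μ.real c := by
  have hdom : ∀ x, |c.indicator s x| ≤ c.indicator 1 x := fun x => by
    by_cases h : x ∈ c <;> simp [h, hs]
  have hgi : ∫ x, c.indicator (1 : ℝ → ℝ) x ∂μ = μ.real c := integral_indicator_one hc
  have hgint : Integrable (c.indicator (1 : ℝ → ℝ)) μ :=
    integrable_of_abs_le (measurable_one.indicator hc) (abs_indicator_le_one (by simp) c)
  have h1 : |(∑ i, c.indicator s (X i)) / (n : ℝ)| ≤ (∑ i, c.indicator 1 (X i)) / (n : ℝ) := by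
    rw [abs_div, Nat.abs_cast]
    gcongr
    exact (Finset.abs_sum_le_sum_abs _ _).trans (Finset.sum_le_sum fun i _ => hdom _)
  have h2 : |∫ x, c.indicator s x ∂μ| ≤ μ.real c := by
    rw [← hgi]
    exact norm_integral_le_of_norm_le (f := c.indicator s) hgint (.of_forall hdom)
  have h3 : (∑ i, c.indicator 1 (X i)) / (n : ℝ) =
      empDev μ X (c.indicator 1) + μ.real c := by
    simp only [empDev, hgi]; ring
  have h4 := le_abs_self (empDev μ X (c.indicator 1))
  have h5 := abs_sub ((∑ i, c.indicator s (X i)) / (n : ℝ)) (∫ x, c.indicator s x ∂μ)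
  simp only [empDev] at h5 ⊢
  simp only [empDev] at h3 h4
  linarith

lemma abs_empDev_indicator_le_of_const (μ : Measure ℝ) {n : ℕ}
    (X : Fin n → ℝ) {s : ℝ → ℝ} (hs : ∀ x, |s x| ≤ 1) {c : Set ℝ}
    (hc : ∀ x ∈ c, ∀ y ∈ c, s x = s y) :
    |empDev μ X (c.indicator s)| ≤ |empDev μ X (c.indicator 1)| := by
  rcases c.eq_empty_or_nonempty with rfl | ⟨z, hz⟩
  · simp [empDev]
  · have : c.indicator s = fun x => s z * c.indicator 1 x := by
      ext x
      by_cases h : x ∈ c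
      · simp [h, hc x h z hz]
      · simp [h]
    rw [this, empDev_const_mul, abs_mul]
    exact mul_le_of_le_one_left (abs_nonneg _) (hs z)

open Classical in
/-- At every scale, `s` is nonconstant on at most `K` of the dyadic cells of `U`. -/
def FewNonconstCells (U : ℝ → ℝ) (K : ℕ) (s : ℝ → ℝ) : Prop :=
  ∀ j, ((Finset.range ((K + 1) * 2 ^ j)).filter fun k =>
    ∃ x ∈ dyadicCell U K j k, ∃ y ∈ dyadicCell U K j k, s x ≠ s y).card ≤ K

lemma measurableSet_dyadicCell {U : ℝ → ℝ} (hU : Monotone U) (K j k : ℕ) :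
    MeasurableSet (dyadicCell U K j k) := (ordConnected_dyadicCell hU K j k).measurableSet

lemma abs_empDev_le_chaining {μ : Measure ℝ} [IsProbabilityMeasure μ] {U : ℝ → ℝ}
    (hU : Monotone U) (hU1 : ∀ x, U x ≤ 1) {K : ℕ} (hK : 0 < K)
    (hcell : ∀ j k, μ.real (dyadicCell U K j k) ≤ 1 / (K * 2 ^ j))
    {n : ℕ} (X : Fin n → ℝ) {s : ℝ → ℝ} (hsm : Measurable s) (hs : ∀ x, |s x| ≤ 1)
    (hcard : FewNonconstCells U K s) {lam : ℕ → ℝ} (hlam : ∀ j, 0 < lam j) (J : ℕ) :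
    |empDev μ X s| ≤ 2 * ∑ j ∈ Finset.range (J + 1), (2 * K * lam j +
        (∑ k ∈ Finset.range ((K + 1) * 2 ^ j),
          empDev μ X ((dyadicCell U K j k).indicator 1) ^ 4) / lam j ^ 3) + 2 / 2 ^ J := by
  have hm := fun j k => measurableSet_dyadicCell hU K j k
  have hint : ∀ j k, Integrable ((dyadicCell U K j k).indicator s) μ := fun j k =>
    integrable_of_abs_le (hsm.indicator (hm j k)) (abs_indicator_le_one hs _)
  have hKr : (0 : ℝ) < K := by exact_mod_cast hK
  have key := chaining_bound
    (a := fun j k => |empDev μ X ((dyadicCell U K j k).indicator s)|)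
    (b := fun j k => |empDev μ X ((dyadicCell U K j k).indicator 1)|)
    (N := K + 1) (K := K) (J := J) (lam := lam) (δ := 2 * (1 / (K * 2 ^ J)))
    (fun _ _ => abs_nonneg _) (fun _ _ => abs_nonneg _) hlam (by positivity) (by omega)
    (fun j k => by
      have := empDev_add μ X (hint (j + 1) (2 * k)) (hint (j + 1) (2 * k + 1))
      rw [← funext (indicator_dyadicCell_eq_add U K j k s)] at this
      rw [this]
      exact abs_add_le _ _)
    (fun j k h => abs_empDev_indicator_le_of_const μ X hs (by push Not at h; exact h))
    hcard
    (fun k => (abs_empDev_indicator_le X hs (hm J k)).trans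
      (by linarith [hcell J k]))
  have h0 : |empDev μ X s| ≤
      ∑ k ∈ Finset.range (K + 1), |empDev μ X ((dyadicCell U K 0 k).indicator s)| := by
    have := empDev_sum μ X (Finset.range (K + 1)) (hint 0)
    simp only [sum_indicator_dyadicCell hU1] at this
    rw [show empDev μ X s = empDev μ X (fun x => s x) from rfl, this]
    exact Finset.abs_sum_le_sum_abs _ _
  refine (h0.trans key).trans (le_of_eq ?_)
  simp only [Even.pow_abs (show Even 4 by decide)]
  congr 1
  field_simp

lemma integral_chaining_error_le {μ : Measure ℝ} [IsProbabilityMeasure μ] {U : ℝ → ℝ}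
    (hU : Monotone U) {K : ℕ} (hK : 0 < K)
    (hcell : ∀ j k, μ.real (dyadicCell U K j k) ≤ 1 / (K * 2 ^ j))
    {n : ℕ} {η : ℝ} (hη : 0 < η) {J : ℕ} (hJ : (K : ℝ) * 2 ^ J ≤ n) :
    ∫ X, (∑ j ∈ Finset.range (J + 1), (∑ k ∈ Finset.range ((K + 1) * 2 ^ j),
        empDev μ X ((dyadicCell U K j k).indicator 1) ^ 4) / ((9 / 10) ^ j * (η / K)) ^ 3)
      ∂(Measure.pi fun _ : Fin n => μ) ≤ 26 * (K : ℝ) ^ 2 / (n ^ 2 * η ^ 3) := by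
  have hKr : (1 : ℝ) ≤ K := by exact_mod_cast hK
  have hn : (0 : ℝ) < n := lt_of_lt_of_le (by positivity) hJ
  have hint : ∀ j k, Integrable (fun X : Fin n → ℝ =>
      empDev μ X ((dyadicCell U K j k).indicator 1) ^ 4) (Measure.pi fun _ : Fin n => μ) := by
    intro j k
    have hm := measurable_empDev μ (n := n)
      (measurable_one.indicator (measurableSet_dyadicCell hU K j k) :
        Measurable ((dyadicCell U K j k).indicator (1 : ℝ → ℝ)))
    refine integrable_of_abs_le (hm.pow_const 4) (B := 2 ^ 4) fun X => ?_
    rw [abs_pow]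
    exact pow_le_pow_left₀ (abs_nonneg _)
      (abs_empDev_le X (abs_indicator_le_one (by simp) _)) 4
  rw [integral_finsetSum _ fun j _ =>
    (integrable_finsetSum _ fun k _ => hint j k).div_const _]
  have hterm : ∀ j ∈ Finset.range (J + 1),
      ∫ X, ((∑ k ∈ Finset.range ((K + 1) * 2 ^ j),
        empDev μ X ((dyadicCell U K j k).indicator 1) ^ 4) / ((9 / 10) ^ j * (η / K)) ^ 3)
        ∂(Measure.pi fun _ : Fin n => μ) ≤
      8 * (K : ℝ) ^ 2 / (n ^ 2 * η ^ 3) * (500 / 729) ^ j := by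
    intro j hj
    have hjJ : (K : ℝ) * 2 ^ j ≤ n := le_trans (mul_le_mul_of_nonneg_left
      (pow_le_pow_right₀ (by norm_num) (Nat.lt_succ_iff.1 (Finset.mem_range.1 hj)))
      (by positivity)) hJ
    rw [integral_div, integral_finsetSum _ fun k _ => hint j k]
    have hsum : ∑ k ∈ Finset.range ((K + 1) * 2 ^ j),
        ∫ X, empDev μ X ((dyadicCell U K j k).indicator 1) ^ 4
          ∂(Measure.pi fun _ : Fin n => μ) ≤
        ((K + 1) * 2 ^ j) * (4 * (1 / (K * 2 ^ j)) ^ 2 / n ^ 2) := by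
      refine (Finset.sum_le_sum fun k _ => integral_empDev_indicator_pow_four_le
        (measurableSet_dyadicCell hU K j k) (hcell j k) ?_).trans (le_of_eq (by simp))
      rw [mul_one_div, le_div_iff₀ (by positivity)]
      linarith
    rw [div_le_iff₀ (by positivity)]
    refine hsum.trans ?_
    have e1 : 8 * (K : ℝ) ^ 2 / (n ^ 2 * η ^ 3) * (500 / 729) ^ j *
        ((9 / 10) ^ j * (η / K)) ^ 3 = 8 / (n ^ 2 * K) * (1 / 2) ^ j := by
      have : ((9 / 10 : ℝ) ^ j) ^ 3 * (500 / 729) ^ j = (1 / 2) ^ j := by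
        rw [← pow_mul, mul_comm j 3, pow_mul, ← mul_pow]; norm_num
      rw [← this]
      field_simp
    have e2 : ((K + 1) * 2 ^ j) * (4 * (1 / (K * 2 ^ j)) ^ 2 / n ^ 2) =
        4 * (K + 1) / (n ^ 2 * K ^ 2) * (1 / 2 : ℝ) ^ j := by
      rw [one_div_pow 2]
      field_simp
    rw [e1, e2]
    refine mul_le_mul_of_nonneg_right ?_ (by positivity)
    rw [div_le_div_iff₀ (by positivity) (by positivity)]
    have : (0 : ℝ) ≤ n ^ 2 * K := by positivity
    nlinarith
  refine (Finset.sum_le_sum hterm).trans ?_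
  rw [← Finset.mul_sum]
  have hgeo : ∑ j ∈ Finset.range (J + 1), (500 / 729 : ℝ) ^ j ≤ 13 / 4 := by
    rw [geom_sum_eq (by norm_num), div_le_iff_of_neg (by norm_num)]
    have : (0 : ℝ) ≤ (500 / 729) ^ (J + 1) := by positivity
    linarith
  calc _ ≤ 8 * (K : ℝ) ^ 2 / (n ^ 2 * η ^ 3) * (13 / 4) :=
        mul_le_mul_of_nonneg_left hgeo (by positivity)
    _ = _ := by ring

/-- Uniform deviation bound at the optimal rate for functions with few nonconstant cells. -/
lemma measure_exists_empDev_gt_le {μ : Measure ℝ} [IsProbabilityMeasure μ] {U : ℝ → ℝ}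
    (hU : Monotone U) (hU1 : ∀ x, U x ≤ 1) {K : ℕ} (hK : 0 < K)
    (hcell : ∀ j k, μ.real (dyadicCell U K j k) ≤ 1 / (K * 2 ^ j))
    {n : ℕ} {η : ℝ} (hη : 0 < η) (hη1 : η < 1) (hn : 25 * (K / η ^ 2) ≤ n) :
    (Measure.pi fun _ : Fin n => μ) {X | ∃ s : ℝ → ℝ, Measurable s ∧ (∀ x, |s x| ≤ 1) ∧
      FewNonconstCells U K s ∧ 43 * η < |empDev μ X s|} ≤ ENNReal.ofReal (1 / 10) := by
  have hKr : (1 : ℝ) ≤ K := by exact_mod_cast hK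
  obtain ⟨J, hJ1, hJ2⟩ := exists_nat_pow_near (one_le_one_div hη hη1.le) (one_lt_two (α := ℝ))
  have hn0 : (0 : ℝ) < n := lt_of_lt_of_le (by positivity) hn
  have hJn : (K : ℝ) * 2 ^ (J + 1) ≤ n := by
    refine le_trans ?_ hn
    rw [pow_succ, ← mul_div_assoc, le_div_iff₀ (by positivity)]
    have h1 : 2 ^ J * η ≤ 1 := (le_div_iff₀ hη).1 hJ1
    have h2 : 2 ^ J * η * η ≤ 1 := by nlinarith
    nlinarith
  set R : (Fin n → ℝ) → ℝ := fun X => ∑ j ∈ Finset.range (J + 1 + 1),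
    (∑ k ∈ Finset.range ((K + 1) * 2 ^ j),
      empDev μ X ((dyadicCell U K j k).indicator 1) ^ 4) / ((9 / 10) ^ j * (η / K)) ^ 3 with hR
  have hR0 : ∀ X, 0 ≤ R X := fun X => Finset.sum_nonneg fun j _ =>
    div_nonneg (Finset.sum_nonneg fun k _ => by positivity) (by positivity)
  have hRint : Integrable R (Measure.pi fun _ : Fin n => μ) := by
    refine integrable_finsetSum _ fun j _ => (integrable_finsetSum _ fun k _ => ?_).div_const _
    have hm := measurable_empDev μ (n := n)
      (measurable_one.indicator (measurableSet_dyadicCell hU K j k) :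
        Measurable ((dyadicCell U K j k).indicator (1 : ℝ → ℝ)))
    refine integrable_of_abs_le (hm.pow_const 4) (B := 2 ^ 4) fun X => ?_
    rw [abs_pow]
    exact pow_le_pow_left₀ (abs_nonneg _)
      (abs_empDev_le X (abs_indicator_le_one (by simp) _)) 4
  have hsub : {X : Fin n → ℝ | ∃ s : ℝ → ℝ, Measurable s ∧ (∀ x, |s x| ≤ 1) ∧
      FewNonconstCells U K s ∧ 43 * η < |empDev μ X s|} ⊆ {X | η / 2 ≤ R X} := by
    rintro X ⟨s, hsm, hs, hcard, hlt⟩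
    have hb := abs_empDev_le_chaining hU hU1 hK hcell X hsm hs hcard
      (lam := fun j => (9 / 10) ^ j * (η / K)) (fun j => by positivity) (J + 1)
    rw [Finset.sum_add_distrib] at hb
    have hl : ∑ j ∈ Finset.range (J + 1 + 1), 2 * (K : ℝ) * ((9 / 10) ^ j * (η / K)) ≤
        20 * η := by
      have : ∀ j, 2 * (K : ℝ) * ((9 / 10) ^ j * (η / K)) = 2 * η * (9 / 10) ^ j := fun j => by
        field_simp
      simp only [this, ← Finset.mul_sum]
      rw [geom_sum_eq (by norm_num)]
      have h0 : (0 : ℝ) ≤ (9 / 10) ^ (J + 1 + 1) := by positivity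
      have : ((9 / 10 : ℝ) ^ (J + 1 + 1) - 1) / (9 / 10 - 1) ≤ 10 := by
        rw [div_le_iff_of_neg (by norm_num)]
        linarith
      nlinarith
    have h2 : 2 / 2 ^ (J + 1) ≤ 2 * η := by
      rw [div_le_iff₀ (by positivity)]
      have := (div_lt_iff₀ hη).1 hJ2
      linarith
    show η / 2 ≤ R X
    have hRX : R X = ∑ j ∈ Finset.range (J + 1 + 1),
      (∑ k ∈ Finset.range ((K + 1) * 2 ^ j),
      empDev μ X ((dyadicCell U K j k).indicator 1) ^ 4) / ((9 / 10) ^ j * (η / K)) ^ 3 := rfl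
    rw [← hRX] at hb
    linarith
  have hmarkov := mul_meas_ge_le_integral_of_nonneg (.of_forall hR0) hRint (η / 2)
  have hER := integral_chaining_error_le hU hK hcell (n := n) hη hJn
  have hreal : (Measure.pi fun _ : Fin n => μ).real {X | η / 2 ≤ R X} ≤ 1 / 10 := by
    have h1 := hmarkov.trans hER
    have hq : (K : ℝ) / (n * η ^ 2) ≤ 1 / 25 := by
      rw [div_le_div_iff₀ (by positivity) (by norm_num)]
      have := (div_le_iff₀ (by positivity)).1 ((mul_div_assoc _ _ _).trans_le hn)
      linarith
    have hq2 : ((K : ℝ) / (n * η ^ 2)) ^ 2 ≤ (1 / 25) ^ 2 :=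
      pow_le_pow_left₀ (by positivity) hq 2
    have e : 26 * (K : ℝ) ^ 2 / (n ^ 2 * η ^ 3) = 26 * (K / (n * η ^ 2)) ^ 2 * η := by
      field_simp
    rw [e] at h1
    by_contra! hc
    nlinarith
  refine (measure_mono hsub).trans ?_
  rw [← ofReal_measureReal]
  exact ENNReal.ofReal_le_ofReal hreal

/-- The distribution function of an atomless probability measure splits the line into dyadic
cells of small mass. -/
lemma exists_monotone_dyadicCell_le (μ : Measure ℝ) [IsProbabilityMeasure μ] [NullSingletonClass μ] :
    ∃ U : ℝ → ℝ, Monotone U ∧ (∀ x, U x ≤ 1) ∧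
      ∀ K j k : ℕ, 0 < K → μ.real (dyadicCell U K j k) ≤ 1 / (K * 2 ^ j) := by
  set U : ℝ → ℝ := fun x => μ.real (Iic x) with hUdef
  have hU : Monotone U := fun x y hxy => measureReal_mono (Iic_subset_Iic.2 hxy)
  have hcont : Continuous U := by
    have hi : Integrable (fun _ : ℝ => (1 : ℝ)) μ := integrable_const _
    have : U = fun x => U 0 + ∫ _ in (0 : ℝ)..x, (1 : ℝ) ∂μ := by
      ext x
      rw [← intervalIntegral.integral_Iic_sub_Iic hi.integrableOn hi.integrableOn]
      simp [hUdef]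
    rw [this]
    exact continuous_const.add (hi.continuous_primitive 0)
  refine ⟨U, hU, fun x => measureReal_le_one, fun K j k hK => ?_⟩
  have hM : (0 : ℝ) < K * 2 ^ j := by positivity
  set S := dyadicCell U K j k with hS
  have hbd : ∀ N : ℕ, μ (S ∩ Icc (-N : ℝ) N) ≤ ENNReal.ofReal (1 / (K * 2 ^ j)) := by
    intro N
    rcases (S ∩ Icc (-N : ℝ) N).eq_empty_or_nonempty with h | hne
    · simp [h]
    have hba : BddAbove (S ∩ Icc (-N : ℝ) N) := bddAbove_Icc.mono inter_subset_right
    have hbb : BddBelow (S ∩ Icc (-N : ℝ) N) := bddBelow_Icc.mono inter_subset_right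
    have hlo : (k : ℝ) ≤ K * 2 ^ j * U (sInf (S ∩ Icc (-N : ℝ) N)) := by
      refine closure_minimal (s := S ∩ Icc (-N : ℝ) N) (t := {x | (k : ℝ) ≤ K * 2 ^ j * U x})
        (fun x hx => ?_) (isClosed_le continuous_const (by fun_prop))
        (csInf_mem_closure hne hbb)
      have hx' : ⌊(K * 2 ^ j : ℝ) * U x⌋₊ = k := hx.1
      rw [Set.mem_ofPred_eq, ← hx']
      exact Nat.floor_le (mul_nonneg hM.le measureReal_nonneg)
    have hhi : K * 2 ^ j * U (sSup (S ∩ Icc (-N : ℝ) N)) ≤ (k : ℝ) + 1 := by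
      refine closure_minimal (s := S ∩ Icc (-N : ℝ) N)
        (t := {x | K * 2 ^ j * U x ≤ (k : ℝ) + 1})
        (fun x hx => ?_) (isClosed_le (by fun_prop) continuous_const)
        (csSup_mem_closure hne hba)
      have hx' : ⌊(K * 2 ^ j : ℝ) * U x⌋₊ = k := hx.1
      rw [Set.mem_ofPred_eq, ← hx']
      exact (Nat.lt_floor_add_one _).le
    have hle : sInf (S ∩ Icc (-N : ℝ) N) ≤ sSup (S ∩ Icc (-N : ℝ) N) :=
      csInf_le_csSup hne hbb hba
    have hdiff : μ.real (Ioc (sInf (S ∩ Icc (-N : ℝ) N)) (sSup (S ∩ Icc (-N : ℝ) N))) =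
        U (sSup (S ∩ Icc (-N : ℝ) N)) - U (sInf (S ∩ Icc (-N : ℝ) N)) := by
      rw [← Iic_sdiff_Iic, measureReal_sdiff (Iic_subset_Iic.2 hle) measurableSet_Iic]
    have hreal : μ.real (S ∩ Icc (-N : ℝ) N) ≤ 1 / (K * 2 ^ j) := by
      calc μ.real (S ∩ Icc (-N : ℝ) N)
          ≤ μ.real (Icc (sInf (S ∩ Icc (-N : ℝ) N)) (sSup (S ∩ Icc (-N : ℝ) N))) :=
            measureReal_mono (subset_Icc_csInf_csSup hbb hba)
        _ = μ.real (Ioc (sInf (S ∩ Icc (-N : ℝ) N)) (sSup (S ∩ Icc (-N : ℝ) N))) :=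
            measureReal_congr Ioc_ae_eq_Icc.symm
        _ ≤ _ := by
            rw [hdiff, le_div_iff₀ hM]
            linarith
    rw [← ofReal_measureReal]
    exact ENNReal.ofReal_le_ofReal hreal
  have hmono : Monotone fun N : ℕ => S ∩ Icc (-N : ℝ) N := fun N N' h => by
    have : (N : ℝ) ≤ N' := by exact_mod_cast h
    exact inter_subset_inter_right _ (Icc_subset_Icc (by linarith) this)
  have hunion : S = ⋃ N : ℕ, S ∩ Icc (-N : ℝ) N := by
    ext x
    simp only [mem_iUnion, mem_inter_iff, mem_Icc, exists_and_left]
    refine ⟨fun h => ⟨h, ?_⟩, fun h => h.1⟩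
    obtain ⟨N, hN⟩ := exists_nat_ge |x|
    exact ⟨N, abs_le.1 hN⟩
  refine ENNReal.toReal_le_of_le_ofReal (by positivity) ?_
  rw [hunion, hmono.measure_iUnion]
  exact iSup_le hbd

lemma PiecewisePoly.indicator_eq_sum {I : Set ℝ} {t d : ℕ} {h : ℝ → ℝ}
    (hh : PiecewisePoly I t d h) :
    ∃ (P : Fin t → Set ℝ) (q : Fin t → Polynomial ℝ), (∀ i, (P i).OrdConnected) ∧
      (∀ i, P i ⊆ I) ∧ I.indicator h = ∑ i, (P i).indicator fun x => (q i).eval x := by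
  classical
  obtain ⟨P, hP, hPd, hPI, hp⟩ := hh
  choose q _ hq using hp
  refine ⟨P, q, hP, fun i => hPI ▸ subset_iUnion P i, ?_⟩
  ext x
  rw [Finset.sum_apply]
  by_cases hx : x ∈ I
  · obtain ⟨i, hi⟩ := Set.mem_iUnion.1 (hPI.symm ▸ hx)
    rw [Finset.sum_eq_single i]
    · simp [hx, hi, hq i x hi]
    · intro j _ hji
      exact indicator_of_notMem (fun hj => Set.disjoint_left.1 (hPd hji) hj hi) _
    · simp
  · rw [indicator_of_notMem hx, Finset.sum_eq_zero]
    intro i _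
    exact indicator_of_notMem (fun hi => hx (hPI ▸ Set.mem_iUnion.2 ⟨i, hi⟩)) _

lemma PiecewisePoly.measurable_indicator {I : Set ℝ} {t d : ℕ} {h : ℝ → ℝ}
    (hh : PiecewisePoly I t d h) : Measurable (I.indicator h) := by
  obtain ⟨P, q, hP, -, he⟩ := hh.indicator_eq_sum
  rw [he, Finset.sum_fn]
  exact Finset.measurable_sum _ fun i _ => (q i).continuous.measurable.indicator (hP i).measurableSet

lemma PiecewisePoly.integrableOn {I : Set ℝ} {t d : ℕ} {h : ℝ → ℝ}
    (hh : PiecewisePoly I t d h) (hI : MeasurableSet I) (hb : Bornology.IsBounded I) :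
    IntegrableOn h I := by
  obtain ⟨P, q, hP, hPI, he⟩ := hh.indicator_eq_sum
  rw [← integrable_indicator_iff hI, he]
  refine integrable_finsetSum' _ fun i _ => ?_
  rw [integrable_indicator_iff (hP i).measurableSet]
  obtain ⟨a, b, hab⟩ := bddBelow_bddAbove_iff_subset_Icc.1 ⟨hb.bddBelow, hb.bddAbove⟩
  exact (q i).continuous.integrableOn_Icc.mono_set ((hPI i).trans hab)

lemma PiecewisePoly.congr {I : Set ℝ} {t d : ℕ} {h g : ℝ → ℝ}
    (hh : PiecewisePoly I t d h) (hg : ∀ x ∈ I, g x = h x) : PiecewisePoly I t d g := by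
  obtain ⟨P, hP, hPd, hPI, hp⟩ := hh
  refine ⟨P, hP, hPd, hPI, fun i => ?_⟩
  obtain ⟨q, hqd, hq⟩ := hp i
  exact ⟨q, hqd, fun x hx => (hg x (hPI ▸ Set.mem_iUnion.2 ⟨i, hx⟩)).trans (hq x hx)⟩

lemma piecewisePoly_zero {I : Set ℝ} (hI : I.OrdConnected) {t : ℕ} (ht : 0 < t) (d : ℕ) :
    PiecewisePoly I t d 0 := by
  classical
  refine ⟨fun i => if i = ⟨0, ht⟩ then I else ∅, fun i => ?_, fun i j hij => ?_, ?_,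
    fun i => ⟨0, by simp, by simp⟩⟩
  · dsimp only
    split_ifs
    · exact hI
    · exact ordConnected_empty
  · by_cases hi : i = ⟨0, ht⟩
    · have hj : j ≠ ⟨0, ht⟩ := fun hj => hij (hi.trans hj.symm)
      simp [hj]
    · simp [hi]
  · ext x
    simp

/-- Piecewise polynomials on a bounded interval are separable in `L¹`. -/
lemma exists_dense_seq_piecewisePoly {I : Set ℝ} (hI : I.OrdConnected)
    (hb : Bornology.IsBounded I) {t : ℕ} (ht : 0 < t) (d : ℕ) :
    ∃ h : ℕ → ℝ → ℝ, (∀ i, PiecewisePoly I t d (h i)) ∧ (∀ i, Measurable (h i)) ∧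
      ∀ r, PiecewisePoly I t d r → ∀ δ : ℝ, 0 < δ → ∃ i, ∫ x in I, |r x - h i x| ≤ δ := by
  have hIm := hI.measurableSet
  let H : Set (ℝ →₁[volume.restrict I] ℝ) := {g | ∃ r, PiecewisePoly I t d r ∧
    g =ᵐ[volume.restrict I] r}
  have mem : ∀ r, ∀ hr : PiecewisePoly I t d r,
      (hr.integrableOn hIm hb).toL1 r ∈ H := fun r hr => ⟨r, hr, Integrable.coeFn_toL1 _⟩
  have : Fact ((1 : ENNReal) ≠ ⊤) := ⟨ENNReal.one_ne_top⟩
  have : Nonempty H := ⟨⟨_, mem 0 (piecewisePoly_zero hI ht d)⟩⟩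
  have hD := TopologicalSpace.denseRange_denseSeq H
  choose r hr hre using fun i => (TopologicalSpace.denseSeq H i).2
  have heq : ∀ i, ∀ x ∈ I, I.indicator (r i) x = r i x := fun i x hx => indicator_of_mem hx _
  refine ⟨fun i => I.indicator (r i), fun i => (hr i).congr (heq i),
    fun i => (hr i).measurable_indicator, fun g hg δ hδ => ?_⟩
  obtain ⟨i, hi⟩ := hD.exists_dist_lt ⟨_, mem g hg⟩ hδ
  refine ⟨i, le_trans (le_of_eq ?_) hi.le⟩
  rw [Subtype.dist_eq, L1.dist_eq_integral_dist]
  refine integral_congr_ae ?_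
  filter_upwards [hre i, Integrable.coeFn_toL1 (hg.integrableOn hIm hb),
    ae_restrict_mem hIm] with x h1 h2 h3
  rw [h1, h2, heq i x h3, Real.dist_eq]

/-- Measurable selection of an approximate minimizer of the suprema of countable families. -/
lemma exists_measurable_almost_minimizer {Ω ι : Type*} [MeasurableSpace Ω] [Countable ι]
    [Nonempty ι] {w : ℕ → ι → Ω → ℝ} (hm : ∀ i p, Measurable (w i p))
    (h0 : ∀ i p ω, 0 ≤ w i p ω) (hb : ∀ i ω, BddAbove (range fun p => w i p ω)) {η : ℝ}
    (hη : 0 < η) :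
    ∃ sel : Ω → ℕ, Measurable sel ∧ ∀ ω p k, ∃ p', w (sel ω) p ω ≤ w k p' ω + η := by
  classical
  have hex : ∀ ω, ∃ i, ∀ p k, ∃ p', w i p ω ≤ w k p' ω + η := by
    intro ω
    have hV0 : ∀ i, 0 ≤ ⨆ p, w i p ω := fun i => Real.iSup_nonneg fun p => h0 i p ω
    have hbb : BddBelow (range fun i => ⨆ p, w i p ω) := ⟨0, by rintro _ ⟨i, rfl⟩; exact hV0 i⟩
    obtain ⟨i, hi⟩ := exists_lt_of_ciInf_lt
      (lt_add_of_pos_right (⨅ i, ⨆ p, w i p ω) (half_pos hη))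
    refine ⟨i, fun p k => ?_⟩
    obtain ⟨p', hp'⟩ := exists_lt_of_lt_ciSup (sub_lt_self (⨆ p, w k p ω) (half_pos hη))
    have h1 := le_ciSup (hb i ω) p
    have h2 := ciInf_le hbb k
    exact ⟨p', by linarith⟩
  refine ⟨fun ω => Nat.find (hex ω), measurable_find hex fun i => ?_,
    fun ω => Nat.find_spec (hex ω)⟩
  have : {ω | ∀ p k, ∃ p', w i p ω ≤ w k p' ω + η} =
      ⋂ p, ⋂ k, ⋃ p', {ω | w i p ω ≤ w k p' ω + η} := by
    ext ω; simp
  rw [this]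
  exact .iInter fun p => .iInter fun k => .iUnion fun p' =>
    measurableSet_le (hm i p) ((hm k p').add_const η)

lemma measurable_signDiff {I : Set ℝ} (hI : MeasurableSet I) {h g : ℝ → ℝ} (hh : Measurable h)
    (hg : Measurable g) : Measurable (signDiff I h g) := by
  have hs : Measurable Real.sign := by
    unfold Real.sign
    exact Measurable.ite measurableSet_Iio measurable_const
      (Measurable.ite measurableSet_Ioi measurable_const measurable_const)
  exact (hs.comp (hh.sub hg)).indicator hI

lemma abs_signDiff_le_one (I : Set ℝ) (h g : ℝ → ℝ) (x : ℝ) : |signDiff I h g x| ≤ 1 := by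
  refine abs_indicator_le_one (fun x => ?_) I x
  rcases Real.sign_apply_eq (h x - g x) with e | e | e <;> simp [e]

lemma signDiff_mul_sub {I : Set ℝ} {h g : ℝ → ℝ} {x : ℝ} (hx : x ∈ I) :
    signDiff I h g x * (h x - g x) = |h x - g x| := by
  rw [signDiff, indicator_of_mem hx]
  rcases lt_trichotomy (h x - g x) 0 with e | e | e
  · rw [Real.sign_of_neg e, abs_of_neg e]; ring
  · simp [e]
  · rw [Real.sign_of_pos e, abs_of_pos e]; ring

lemma isProbabilityMeasure_densityMeasure {I : Set ℝ} (hI : MeasurableSet I) {f : ℝ → ℝ}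
    (hf : IsPDFOn f I) : IsProbabilityMeasure (densityMeasure I f) := by
  refine ⟨?_⟩
  rw [densityMeasure, withDensity_apply _ MeasurableSet.univ, Measure.restrict_univ,
    ← ofReal_integral_eq_lintegral_ofReal hf.2.1 (ae_restrict_of_forall_mem hI hf.1), hf.2.2,
    ENNReal.ofReal_one]

lemma nullSingletonClass_densityMeasure (I : Set ℝ) (f : ℝ → ℝ) :
    NullSingletonClass (densityMeasure I f) :=
  ⟨fun x => withDensity_absolutelyContinuous _ _ (measure_singleton x)⟩

lemma integral_densityMeasure {I : Set ℝ} (hI : MeasurableSet I) {f : ℝ → ℝ}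
    (hf : IsPDFOn f I) (g : ℝ → ℝ) :
    ∫ x, g x ∂(densityMeasure I f) = ∫ x in I, g x * f x := by
  rw [densityMeasure, integral_withDensity_eq_integral_toReal_smul₀
    hf.2.1.aestronglyMeasurable.aemeasurable.ennreal_ofReal (by simp)]
  refine setIntegral_congr_fun hI fun x hx => ?_
  simp [ENNReal.toReal_ofReal (hf.1 x hx), mul_comm]

/-- The distance between the integral of `s` against `h` and its empirical mean. -/
noncomputable def testDiscrepancy (I : Set ℝ) {n : ℕ} (h s : ℝ → ℝ) (X : Fin n → ℝ) : ℝ :=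
  |(∫ x in I, s x * h x) - (∑ i, s (X i)) / n|

lemma measurable_testDiscrepancy (I : Set ℝ) {n : ℕ} (h : ℝ → ℝ) {s : ℝ → ℝ}
    (hs : Measurable s) : Measurable (testDiscrepancy I h s : (Fin n → ℝ) → ℝ) := by
  unfold testDiscrepancy
  fun_prop

lemma abs_setIntegral_mul_le {I : Set ℝ} {h s : ℝ → ℝ} (hh : IntegrableOn h I)
    (hs : ∀ x, |s x| ≤ 1) : |∫ x in I, s x * h x| ≤ ∫ x in I, |h x| := by
  refine norm_integral_le_of_norm_le (f := fun x => s x * h x) hh.abs (.of_forall fun x => ?_)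
  rw [Real.norm_eq_abs, abs_mul]
  exact mul_le_of_le_one_left (abs_nonneg _) (hs x)

lemma integrableOn_mul_of_abs_le_one {I : Set ℝ} {h s : ℝ → ℝ} (hh : IntegrableOn h I)
    (hsm : Measurable s) (hs : ∀ x, |s x| ≤ 1) : IntegrableOn (fun x => s x * h x) I :=
  Integrable.bdd_mul (c := 1) hh hsm.aestronglyMeasurable (.of_forall hs)

lemma testDiscrepancy_le_integral_add_one {I : Set ℝ} {n : ℕ} {h s : ℝ → ℝ}
    (hh : IntegrableOn h I) (hs : ∀ x, |s x| ≤ 1) (X : Fin n → ℝ) :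
    testDiscrepancy I h s X ≤ (∫ x in I, |h x|) + 1 := by
  refine (abs_sub _ _).trans (add_le_add (abs_setIntegral_mul_le hh hs) ?_)
  rw [abs_div, Nat.abs_cast]
  exact div_le_one_of_le₀ ((Finset.abs_sum_le_sum_abs _ _).trans
    ((Finset.sum_le_sum fun i _ => hs (X i)).trans (by simp))) (by positivity)

lemma testDiscrepancy_le {I : Set ℝ} (hI : MeasurableSet I) {f : ℝ → ℝ} (hf : IsPDFOn f I)
    {n : ℕ} {h s : ℝ → ℝ} (hh : IntegrableOn h I) (hsm : Measurable s)
    (hs : ∀ x, |s x| ≤ 1) (X : Fin n → ℝ) :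
    testDiscrepancy I h s X ≤ (∫ x in I, |f x - h x|) + |empDev (densityMeasure I f) X s| := by
  have h1 := abs_setIntegral_mul_le (hf.2.1.sub hh) hs
  have h2 : ∫ x in I, s x * (f - h) x = (∫ x in I, s x * f x) - ∫ x in I, s x * h x := by
    rw [← integral_sub (integrableOn_mul_of_abs_le_one hf.2.1 hsm hs)
      (integrableOn_mul_of_abs_le_one hh hsm hs)]
    simp only [Pi.sub_apply, mul_sub]
  have h3 : (∫ x in I, s x * h x) - (∑ i, s (X i)) / n =
      -(∫ x in I, s x * (f - h) x) - empDev (densityMeasure I f) X s := by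
    rw [h2, empDev, integral_densityMeasure hI hf]
    ring
  rw [testDiscrepancy, h3]
  exact (abs_sub _ _).trans (by rw [abs_neg]; simpa using h1)

lemma integral_abs_sub_le_add {I : Set ℝ} {f g h : ℝ → ℝ} (hf : IntegrableOn f I)
    (hg : IntegrableOn g I) (hh : IntegrableOn h I) :
    ∫ x in I, |f x - h x| ≤ (∫ x in I, |f x - g x|) + ∫ x in I, |g x - h x| := by
  have h₁ : Integrable (fun x => |f x - g x|) (volume.restrict I) := (hf.sub hg).abs
  have h₂ : Integrable (fun x => |g x - h x|) (volume.restrict I) := (hg.sub hh).abs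
  have h₃ : Integrable (fun x => |f x - h x|) (volume.restrict I) := (hf.sub hh).abs
  rw [← integral_add h₁ h₂]
  exact integral_mono h₃ (h₁.add h₂) fun x => abs_sub_le _ _ _

/-- A minimum distance selection is within three times the error of any competitor, up to the
uniform deviation of the tests. -/
lemma integral_abs_sub_le_of_testDiscrepancy {I : Set ℝ} (hI : MeasurableSet I) {f : ℝ → ℝ}
    (hf : IsPDFOn f I) {n : ℕ} (X : Fin n → ℝ) {ι : Type*} {h : ι → ℝ → ℝ}
    (hm : ∀ i, Measurable (h i)) (hint : ∀ i, IntegrableOn (h i) I) {i k : ι} {η τ : ℝ}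
    (hdev : ∀ p : ι × ι, |empDev (densityMeasure I f) X (signDiff I (h p.1) (h p.2))| ≤ τ)
    (hsel : ∀ p : ι × ι, ∃ p' : ι × ι,
      testDiscrepancy I (h i) (signDiff I (h p.1) (h p.2)) X ≤
        testDiscrepancy I (h k) (signDiff I (h p'.1) (h p'.2)) X + η) :
    ∫ x in I, |f x - h i x| ≤ 3 * (∫ x in I, |f x - h k x|) + 2 * τ + η := by
  have hsm : ∀ p : ι × ι, Measurable (signDiff I (h p.1) (h p.2)) := fun p =>
    measurable_signDiff hI (hm _) (hm _)
  have hs : ∀ p : ι × ι, ∀ x, |signDiff I (h p.1) (h p.2) x| ≤ 1 := fun p =>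
    abs_signDiff_le_one I _ _
  obtain ⟨p', hp'⟩ := hsel (k, i)
  have h1 : testDiscrepancy I (h k) (signDiff I (h k) (h i)) X ≤
      (∫ x in I, |f x - h k x|) + τ :=
    (testDiscrepancy_le hI hf (hint k) (hsm (k, i)) (hs (k, i)) X).trans
      (by linarith [hdev (k, i)])
  have h2 := (testDiscrepancy_le hI hf (hint k) (hsm p') (hs p') X).trans
      (add_le_add_right (hdev p') _)
  have h3 : ∫ x in I, |h k x - h i x| =
      (∫ x in I, signDiff I (h k) (h i) x * h k x) -
        ∫ x in I, signDiff I (h k) (h i) x * h i x := by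
    rw [← integral_sub (integrableOn_mul_of_abs_le_one (hint k) (hsm (k, i)) (hs (k, i)))
      (integrableOn_mul_of_abs_le_one (hint i) (hsm (k, i)) (hs (k, i)))]
    refine setIntegral_congr_fun hI fun x hx => ?_
    simp only [← mul_sub, signDiff_mul_sub hx]
  have h4 : ∫ x in I, |h k x - h i x| ≤
      testDiscrepancy I (h k) (signDiff I (h k) (h i)) X +
        testDiscrepancy I (h i) (signDiff I (h k) (h i)) X := by
    rw [h3, testDiscrepancy, testDiscrepancy]
    refine le_trans (le_of_eq (by ring)) ((le_abs_self _).trans (abs_sub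
      ((∫ x in I, signDiff I (h k) (h i) x * h k x) -
        (∑ l, signDiff I (h k) (h i) (X l)) / n) _))
  have h5 : ∫ x in I, |f x - h i x| ≤
      (∫ x in I, |f x - h k x|) + ∫ x in I, |h k x - h i x| :=
    integral_abs_sub_le_add hf.2.1 (hint k) (hint i)
  simp only at hp'
  linarith

lemma exists_integral_abs_sub_le_OPTpoly_add {I : Set ℝ} (hI : I.OrdConnected)
    (hb : Bornology.IsBounded I) {t d : ℕ} (ht : 0 < t) {f : ℝ → ℝ} (hf : IsPDFOn f I)
    {h : ℕ → ℝ → ℝ} (hh : ∀ i, PiecewisePoly I t d (h i))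
    (hdense : ∀ r, PiecewisePoly I t d r → ∀ δ : ℝ, 0 < δ →
      ∃ i, ∫ x in I, |r x - h i x| ≤ δ) {δ : ℝ} (hδ : 0 < δ) :
    ∃ k, ∫ x in I, |f x - h k x| ≤ OPTpoly I t d f + 2 * δ := by
  have hIm := hI.measurableSet
  obtain ⟨_, ⟨r, hr, rfl⟩, hlt⟩ := exists_lt_of_csInf_lt
    (s := {y : ℝ | ∃ r : ℝ → ℝ, PiecewisePoly I t d r ∧ y = ∫ x in I, |f x - r x|})
    ⟨_, 0, piecewisePoly_zero hI ht d, rfl⟩ (lt_add_of_pos_right (OPTpoly I t d f) hδ)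
  obtain ⟨k, hk⟩ := hdense r hr δ hδ
  refine ⟨k, ?_⟩
  have hri := hr.integrableOn hIm hb
  have hki := (hh k).integrableOn hIm hb
  have : ∫ x in I, |f x - h k x| ≤ (∫ x in I, |f x - r x|) + ∫ x in I, |r x - h k x| :=
    integral_abs_sub_le_add hf.2.1 hri hki
  linarith

lemma OPTpoly_nonneg (I : Set ℝ) (t d : ℕ) (f : ℝ → ℝ) : 0 ≤ OPTpoly I t d f := by
  refine Real.sInf_nonneg ?_
  rintro _ ⟨r, -, rfl⟩
  exact integral_nonneg fun x => abs_nonneg _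

/-- (Main theorem, statistical content) For every `γ > 0` there exist a constant
`C₁(γ) > 0` and an absolute constant `C₂ > 0` such that: for all positive integers `t` and
all `d`, every `ε ∈ (0,1)`, every bounded interval `I ⊆ ℝ`, and every
`n ≥ C₁(γ)·t·(d+1)/ε²`, there is a measurable estimator `A` mapping `n` samples to a
piecewise polynomial with at most `C₂·t` pieces of degree at most `d` such that for every
pdf `f` on `I`, with probability at least `9/10` over `n` i.i.d. samples from `f`, the
hypothesis `h = A(X)` satisfies `∫_I |f − h| ≤ (3+γ)·OPT_{t,d}(f) + ε`. -/
theorem stmt17 : ∃ C₂ : ℕ, 0 < C₂ ∧ ∀ γ : ℝ, 0 < γ → ∃ C₁ : ℝ, 0 < C₁ ∧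
    ∀ (t d : ℕ) (ε : ℝ) (I : Set ℝ) (n : ℕ),
      0 < t → 0 < ε → ε < 1 →
      I.OrdConnected → MeasurableSet I → Bornology.IsBounded I →
      C₁ * ((t : ℝ) * ((d : ℝ) + 1) / ε ^ 2) ≤ (n : ℝ) →
      ∃ A : (Fin n → ℝ) → ℝ → ℝ,
        Measurable (fun p : (Fin n → ℝ) × ℝ => A p.1 p.2) ∧
        (∀ X, PiecewisePoly I (C₂ * t) d (A X)) ∧
        ∀ f : ℝ → ℝ, IsPDFOn f I →
          ENNReal.ofReal ((9 : ℝ) / 10) ≤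
            (Measure.pi fun _ : Fin n => densityMeasure I f)
              {X | (∫ x in I, |f x - A X x|) ≤ (3 + γ) * OPTpoly I t d f + ε} := by
  refine ⟨1, one_pos, fun γ hγ => ⟨1000000, by norm_num, ?_⟩⟩
  intro t d ε I n ht hε hε1 hI hIm hb hn
  rw [one_mul]
  obtain ⟨h, hh, hm, hdense⟩ := exists_dense_seq_piecewisePoly hI hb ht d
  have hint : ∀ i, IntegrableOn (h i) I := fun i => (hh i).integrableOn hIm hb
  have hη : 0 < ε / 100 := by positivity
  have hsm : ∀ p : ℕ × ℕ, Measurable (signDiff I (h p.1) (h p.2)) := fun p =>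
    measurable_signDiff hIm (hm _) (hm _)
  have hs : ∀ p : ℕ × ℕ, ∀ x, |signDiff I (h p.1) (h p.2) x| ≤ 1 := fun p =>
    abs_signDiff_le_one I _ _
  obtain ⟨sel, hselm, hsel⟩ := exists_measurable_almost_minimizer
    (w := fun i (p : ℕ × ℕ) (X : Fin n → ℝ) =>
      testDiscrepancy I (h i) (signDiff I (h p.1) (h p.2)) X)
    (fun i p => measurable_testDiscrepancy I (h i) (hsm p))
    (fun i p X => abs_nonneg _)
    (fun i X => ⟨(∫ x in I, |h i x|) + 1, by
      rintro _ ⟨p, rfl⟩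
      exact testDiscrepancy_le_integral_add_one (hint i) (hs p) X⟩) hη
  refine ⟨fun X => h (sel X), ?_, fun X => hh _, fun f hf => ?_⟩
  · have hjoint : Measurable fun q : ℕ × ℝ => h q.1 q.2 :=
      measurable_from_prod_countable_right fun i => hm i
    exact hjoint.comp ((hselm.comp measurable_fst).prodMk measurable_snd)
  have := isProbabilityMeasure_densityMeasure hIm hf
  have := nullSingletonClass_densityMeasure I f
  obtain ⟨U, hU, hU1, hcell⟩ := exists_monotone_dyadicCell_le (densityMeasure I f)
  have hK : 0 < 4 * (t * (d + 1)) := by positivity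
  have hbad := measure_exists_empDev_gt_le hU hU1 hK (fun j k => hcell _ j k hK) (n := n) hη
    (by linarith) (by
      refine le_trans (le_of_eq ?_) hn
      push_cast
      field_simp
      norm_num)
  obtain ⟨k, hk⟩ := exists_integral_abs_sub_le_OPTpoly_add hI hb ht hf hh hdense hη
  set bad := {X : Fin n → ℝ | ∃ s : ℝ → ℝ, Measurable s ∧ (∀ x, |s x| ≤ 1) ∧
    FewNonconstCells U (4 * (t * (d + 1))) s ∧
    43 * (ε / 100) < |empDev (densityMeasure I f) X s|} with hbaddef
  have hgood : badᶜ ⊆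
      {X | (∫ x in I, |f x - h (sel X) x|) ≤ (3 + γ) * OPTpoly I t d f + ε} := by
    intro X hX
    have hdev : ∀ p : ℕ × ℕ,
        |empDev (densityMeasure I f) X (signDiff I (h p.1) (h p.2))| ≤ 43 * (ε / 100) := by
      intro p
      by_contra! hlt
      exact hX ⟨_, hsm p, hs p, fun j => card_signDiff_nonconst_le (hh p.1) (hh p.2) _ _
        (ordConnected_dyadicCell hU _ j) (disjoint_dyadicCell U _ j), hlt⟩
    have hfin := integral_abs_sub_le_of_testDiscrepancy hIm hf X hm hint (i := sel X) (k := k)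
      hdev fun p => hsel X p k
    have := mul_nonneg hγ.le (OPTpoly_nonneg I t d f)
    rw [Set.mem_ofPred_eq]
    linarith
  refine le_trans ?_ (measure_mono hgood)
  have htotal : 1 ≤ (Measure.pi fun _ : Fin n => densityMeasure I f) bad +
      (Measure.pi fun _ : Fin n => densityMeasure I f) badᶜ := by
    rw [← measure_univ (μ := Measure.pi fun _ : Fin n => densityMeasure I f),
      ← Set.union_compl_self bad]
    exact measure_union_le _ _
  have hsplit : (1 : ENNReal) = ENNReal.ofReal (1 / 10) + ENNReal.ofReal (9 / 10) := by
    rw [← ENNReal.ofReal_add (by norm_num) (by norm_num)]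
    norm_num
  rw [hsplit] at htotal
  exact (ENNReal.add_le_add_iff_left ENNReal.ofReal_ne_top).1
    (htotal.trans (add_le_add_left hbad _))
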